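/- Let m, n ≥ 1 and let B_1, …, B_{m+n} be 2×2 real matrices, each of the form [[1+jk, k],[j, 1]] for some positive integers j, k. Then ‖B_{m+n} ⋯ B_{m+1}‖ · ‖B_m ⋯ B_1‖ ≥ ‖B_{m+n} ⋯ B_1‖ ≥ (1/(2√2)) ‖B_{m+n} ⋯ B_{m+1}‖ · ‖B_m ⋯ B_1‖, where ‖·‖ is the operator norm induced by the Euclidean norm on ℝ². -/

import Mathlib

/-- Membership in the class `𝒞` of 2×2 real matrices of the form
`[[1 + j k, k],[j, 1]]` with `j, k` positive integers. -/
def InClassC (M : Matrix (Fin 2) (Fin 2) ℝ) : Prop :=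
  ∃ j k : ℕ, 1 ≤ j ∧ 1 ≤ k ∧
    M = !![1 + (j : ℝ) * (k : ℝ), (k : ℝ); (j : ℝ), 1]

/-- The operator norm on 2×2 real matrices induced by the Euclidean norm on `ℝ²`. -/
noncomputable def opNorm (M : Matrix (Fin 2) (Fin 2) ℝ) : ℝ :=
  ‖Matrix.toEuclideanCLM (𝕜 := ℝ) M‖


def Dom (M : Matrix (Fin 2) (Fin 2) ℝ) : Prop :=
  0 ≤ M 1 1 ∧ M 1 1 ≤ M 0 1 ∧ M 1 1 ≤ M 1 0 ∧ M 0 1 ≤ M 0 0 ∧ M 1 0 ≤ M 0 0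

lemma dom_of_class {M : Matrix (Fin 2) (Fin 2) ℝ} (h : InClassC M) : Dom M := by
  obtain ⟨j, k, hj, hk, rfl⟩ := h
  have hj' : (1 : ℝ) ≤ j := by exact_mod_cast hj
  have hk' : (1 : ℝ) ≤ k := by exact_mod_cast hk
  refine ⟨?_, ?_, ?_, ?_, ?_⟩ <;> simp <;> nlinarith

lemma dom_mul {P Q : Matrix (Fin 2) (Fin 2) ℝ} (hP : Dom P) (hQ : Dom Q) : Dom (P * Q) := by
  obtain ⟨p1, p2, p3, p4, p5⟩ := hP
  obtain ⟨q1, q2, q3, q4, q5⟩ := hQ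
  have a1 : 0 ≤ P 0 1 := p1.trans p2
  have a2 : 0 ≤ P 1 0 := p1.trans p3
  have a3 : 0 ≤ P 0 0 := a2.trans p5
  have b1 : 0 ≤ Q 0 1 := q1.trans q2
  have b2 : 0 ≤ Q 1 0 := q1.trans q3
  have b3 : 0 ≤ Q 0 0 := b2.trans q5
  unfold Dom
  simp only [Matrix.mul_apply, Fin.sum_univ_two]
  refine ⟨by positivity, ?_, ?_, ?_, ?_⟩ <;> gcongr

lemma dom_list (l : List (Matrix (Fin 2) (Fin 2) ℝ)) (hl : l ≠ []) (h : ∀ M ∈ l, Dom M) :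
    Dom l.prod := by
  induction l with
  | nil => exact absurd rfl hl
  | cons a t ih =>
    rcases t with _ | ⟨b, t⟩
    · simpa using h
    · rw [List.prod_cons]
      exact dom_mul (h a (by simp)) (ih (by simp) fun M hM => h M (List.mem_cons_of_mem _ hM))

lemma opNorm_mul_le (P Q : Matrix (Fin 2) (Fin 2) ℝ) : opNorm (P * Q) ≤ opNorm P * opNorm Q := by
  unfold opNorm
  rw [map_mul]
  exact norm_mul_le _ _

lemma opNorm_nonneg (P : Matrix (Fin 2) (Fin 2) ℝ) : 0 ≤ opNorm P := norm_nonneg _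

lemma opNorm_le_frob (M : Matrix (Fin 2) (Fin 2) ℝ) :
    opNorm M ≤ √(M 0 0 ^ 2 + M 0 1 ^ 2 + M 1 0 ^ 2 + M 1 1 ^ 2) := by
  unfold opNorm
  refine ContinuousLinearMap.opNorm_le_bound _ (Real.sqrt_nonneg _) fun x => ?_
  rw [EuclideanSpace.norm_eq, EuclideanSpace.norm_eq, ← Real.sqrt_mul (by positivity)]
  apply Real.sqrt_le_sqrt
  simp only [Fin.sum_univ_two, Real.norm_eq_abs, sq_abs, Matrix.ofLp_toEuclideanCLM,
    Matrix.mulVec, dotProduct]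
  nlinarith [sq_nonneg (M 0 0 * x 1 - M 0 1 * x 0), sq_nonneg (M 1 0 * x 1 - M 1 1 * x 0)]

lemma le_opNorm (M : Matrix (Fin 2) (Fin 2) ℝ) (u v : ℝ) :
    √((M 0 0 * u + M 0 1 * v) ^ 2 + (M 1 0 * u + M 1 1 * v) ^ 2) ≤
      opNorm M * √(u ^ 2 + v ^ 2) := by
  have := (Matrix.toEuclideanCLM (𝕜 := ℝ) M).le_opNorm !₂[u, v]
  rw [EuclideanSpace.norm_eq, EuclideanSpace.norm_eq] at this
  unfold opNorm
  simpa only [Fin.sum_univ_two, Real.norm_eq_abs, sq_abs, Matrix.ofLp_toEuclideanCLM,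
    Matrix.mulVec, dotProduct, Matrix.cons_val_zero, Matrix.cons_val_one] using this

lemma half_le {P Q : Matrix (Fin 2) (Fin 2) ℝ} (hP : Dom P) (hQ : Dom Q) :
    opNorm P * opNorm Q ≤ 2 * opNorm (P * Q) := by
  obtain ⟨p1, p2, p3, p4, p5⟩ := hP
  obtain ⟨q1, q2, q3, q4, q5⟩ := hQ
  have a1 : 0 ≤ P 0 1 := p1.trans p2
  have a2 : 0 ≤ P 1 0 := p1.trans p3
  have a3 : 0 ≤ P 0 0 := a2.trans p5
  have b1 : 0 ≤ Q 0 1 := q1.trans q2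
  have b2 : 0 ≤ Q 1 0 := q1.trans q3
  have b3 : 0 ≤ Q 0 0 := b2.trans q5
  set s := √(P 0 0 ^ 2 + P 1 0 ^ 2) with hs
  set t := √(Q 0 0 ^ 2 + Q 0 1 ^ 2) with ht
  have s0 : 0 ≤ s := Real.sqrt_nonneg _
  have t0 : 0 ≤ t := Real.sqrt_nonneg _
  have hP' : opNorm P ≤ √2 * s := by
    refine (opNorm_le_frob P).trans ?_
    rw [hs, ← Real.sqrt_mul (by norm_num)]
    apply Real.sqrt_le_sqrt
    nlinarith
  have hQ' : opNorm Q ≤ √2 * t := by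
    refine (opNorm_le_frob Q).trans ?_
    rw [ht, ← Real.sqrt_mul (by norm_num)]
    apply Real.sqrt_le_sqrt
    nlinarith
  have h2 : √2 * √2 = (2 : ℝ) := Real.mul_self_sqrt (by norm_num)
  have key : opNorm P * opNorm Q ≤ 2 * (s * t) := by
    calc _ ≤ (√2 * s) * (√2 * t) := mul_le_mul hP' hQ' (opNorm_nonneg _) (by positivity)
      _ = (√2 * √2) * (s * t) := by ring
      _ = _ := by rw [h2]
  have low : s * (t * t) ≤ opNorm (P * Q) * t := by
    refine le_trans ?_ (le_opNorm (P * Q) (Q 0 0) (Q 0 1))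
    apply Real.le_sqrt_of_sq_le
    have tt : t * t = Q 0 0 ^ 2 + Q 0 1 ^ 2 := Real.mul_self_sqrt (by positivity)
    have ss : s ^ 2 = P 0 0 ^ 2 + P 1 0 ^ 2 := Real.sq_sqrt (by positivity)
    rw [mul_pow, ss, tt, add_mul, ← mul_pow, ← mul_pow]
    simp only [Matrix.mul_apply, Fin.sum_univ_two]
    have c : 0 ≤ Q 1 0 * Q 0 0 + Q 1 1 * Q 0 1 := by positivity
    have c1 := mul_nonneg a1 c
    have c2 := mul_nonneg p1 c
    apply add_le_add
    · apply pow_le_pow_left₀ (by positivity)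
      nlinarith
    · apply pow_le_pow_left₀ (by positivity)
      nlinarith
  have fin : s * t ≤ opNorm (P * Q) := by
    rcases t0.eq_or_lt with h | h
    · rw [← h, mul_zero]; exact opNorm_nonneg _
    · refine le_of_mul_le_mul_right ?_ h
      linarith
  linarith

/-- **almost additivity.** For `m, n ≥ 1` and matrices
`B₁, …, B_{m+n} ∈ 𝒞`,
`‖B_{m+n} ⋯ B_{m+1}‖ ‖B_m ⋯ B₁‖ ≥ ‖B_{m+n} ⋯ B₁‖ ≥ (1/(2√2)) ‖B_{m+n} ⋯ B_{m+1}‖ ‖B_m ⋯ B₁‖`. -/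
theorem stmt9 (m n : ℕ) (hm : 1 ≤ m) (hn : 1 ≤ n)
    (B : Fin (m + n) → Matrix (Fin 2) (Fin 2) ℝ) (hB : ∀ l, InClassC (B l)) :
    opNorm (((List.ofFn B).reverse).prod)
        ≤ opNorm (((List.ofFn fun l : Fin n => B (Fin.natAdd m l)).reverse).prod)
          * opNorm (((List.ofFn fun l : Fin m => B (Fin.castAdd n l)).reverse).prod) ∧
      (1 / (2 * Real.sqrt 2))
          * (opNorm (((List.ofFn fun l : Fin n => B (Fin.natAdd m l)).reverse).prod)
            * opNorm (((List.ofFn fun l : Fin m => B (Fin.castAdd n l)).reverse).prod))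
        ≤ opNorm (((List.ofFn B).reverse).prod) := by
  have e : ((List.ofFn B).reverse).prod =
      ((List.ofFn fun l : Fin n => B (Fin.natAdd m l)).reverse).prod *
        ((List.ofFn fun l : Fin m => B (Fin.castAdd n l)).reverse).prod := by
    rw [List.ofFn_add, List.reverse_append, List.prod_append]
    rfl
  have hP : Dom ((List.ofFn fun l : Fin n => B (Fin.natAdd m l)).reverse).prod := by
    apply dom_list
    · simp; omega
    · intro M hM
      rw [List.mem_reverse, List.mem_ofFn] at hM
      obtain ⟨i, rfl⟩ := hM
      exact dom_of_class (hB _)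
  have hQ : Dom ((List.ofFn fun l : Fin m => B (Fin.castAdd n l)).reverse).prod := by
    apply dom_list
    · simp; omega
    · intro M hM
      rw [List.mem_reverse, List.mem_ofFn] at hM
      obtain ⟨i, rfl⟩ := hM
      exact dom_of_class (hB _)
  rw [e]
  refine ⟨opNorm_mul_le _ _, ?_⟩
  have h := half_le hP hQ
  have h1 : (1 : ℝ) ≤ √2 := Real.one_le_sqrt.2 (by norm_num)
  rw [one_div, inv_mul_le_iff₀ (by positivity)]
  refine h.trans ?_
  apply mul_le_mul_of_nonneg_right _ (opNorm_nonneg _)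
  linarith
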